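/- arXiv:2108.11580 — 5 statements merged into one kernel-verified Lean document; each statement's English description precedes it below -/
import Mathlib

section
/- Let Y be a real Hilbert space, n ≥ 1, r ≥ 1 integers, and λ > 0. Let u = (u_1,…,u_n) ∈ Yⁿ, let T¹,…,T^r ∈ Yⁿ, and let Σ_{ij} : Y → Y (1 ≤ i,j ≤ n) be bounded linear operators with Σ_{ij}* = Σ_{ji} such that the operator M : Yⁿ → Yⁿ defined by (M h)_i = ∑_{j=1}^n Σ_{ij} h_j is positive semidefinite, i.e. ⟨M h, h⟩_{Yⁿ} ≥ 0 for all h ∈ Yⁿ. Then M_λ := M + nλ·Id is a self-adjoint, strictly positive, boundedly invertible operator on Yⁿ, and if the r × r matrix 𝐀 with entries 𝐀_{kl} = ⟨T^k, M_λ^{-1}(T^l)⟩_{Yⁿ} is invertible, then the pair (d*, c*) ∈ ℝ^r × Yⁿ given by d* = 𝐀^{-1}( ⟨T^1, M_λ^{-1}(u)⟩_{Yⁿ}, …, ⟨T^r, M_λ^{-1}(u)⟩_{Yⁿ} )ᵀ and c* = M_λ^{-1}(u) − ∑_{k=1}^r d*_k M_λ^{-1}(T^k) minimizes over (d, c) ∈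 ℝ^r × Yⁿ the ridge objective F(d, c) = ∑_{i=1}^n ‖u_i − ∑_{k=1}^r d_k T_i^k − ∑_{j=1}^n Σ_{ij} c_j‖²_Y + nλ ∑_{i=1}^n ∑_{j=1}^n ⟨c_i, Σ_{ij} c_j⟩_Y. -/
open scoped RealInnerProductSpace
open Matrix

section Ridge

variable {E : Type*} [NormedAddCommGroup E] [InnerProductSpace ℝ E]

/-- A positive semidefinite operator becomes invertible after adding a positive multiple of the
identity. -/
lemma isUnit_add_smul_one_of_inner_nonneg [CompleteSpace E] (M : E →L[ℝ] E)
    (hM : ∀ x, 0 ≤ ⟪M x, x⟫) {a : ℝ} (ha : 0 < a) : IsUnit (M + a • (1 : E →L[ℝ] E)) := by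
  refine ContinuousLinearMap.isUnit_of_forall_le_norm_inner_map _ (c := .mk a ha.le) ha fun x => ?_
  have hx : ⟪(M + a • (1 : E →L[ℝ] E)) x, x⟫ = ⟪M x, x⟫ + a * ‖x‖ ^ 2 := by
    simp [inner_add_left, real_inner_smul_left]
  rw [hx, NNReal.coe_mk]
  exact le_trans (by linarith [hM x]) (le_abs_self _)

/-- A stationary point of the ridge objective is a global minimizer. -/
lemma ridge_objective_le_of_stationary {ι : Type*} [Fintype ι] (M : E →L[ℝ] E)
    (hsymm : ∀ x y, ⟪M x, y⟫ = ⟪x, M y⟫) (hM : ∀ x, 0 ≤ ⟪M x, x⟫) {a : ℝ} (ha : 0 ≤ a)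
    (u : E) (T : ι → E) {d₀ : ι → ℝ} {c₀ : E}
    (hres : M c₀ + a • c₀ = u - ∑ k, d₀ k • T k) (horth : ∀ k, ⟪T k, c₀⟫ = 0)
    (d : ι → ℝ) (c : E) :
    ‖u - ∑ k, d₀ k • T k - M c₀‖ ^ 2 + a * ⟪c₀, M c₀⟫ ≤
      ‖u - ∑ k, d k • T k - M c‖ ^ 2 + a * ⟪c, M c⟫ := by
  obtain ⟨e, rfl⟩ : ∃ e, c = c₀ + e := ⟨c - c₀, by abel⟩
  set t := ∑ k, (d k - d₀ k) • T k with ht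
  have hT : ∑ k, d k • T k = ∑ k, d₀ k • T k + t := by
    simp [ht, sub_smul, Finset.sum_sub_distrib]
  have htc : ⟪c₀, t⟫ = 0 := by
    rw [real_inner_comm, ht, sum_inner]
    simp [real_inner_smul_left, horth]
  have h₀ : u - ∑ k, d₀ k • T k - M c₀ = a • c₀ := by rw [← hres]; abel
  have h₁ : u - ∑ k, d k • T k - M (c₀ + e) = a • c₀ - (t + M e) := by
    rw [hT, map_add, ← h₀]; abel
  have hexp : ‖a • c₀ - (t + M e)‖ ^ 2 =
      ‖a • c₀‖ ^ 2 - 2 * (a * ⟪c₀, M e⟫) + ‖t + M e‖ ^ 2 := by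
    rw [norm_sub_sq_real, real_inner_smul_left, inner_add_right, htc, zero_add]
  have hquad : ⟪c₀ + e, M (c₀ + e)⟫ = ⟪c₀, M c₀⟫ + 2 * ⟪c₀, M e⟫ + ⟪M e, e⟫ := by
    rw [map_add, inner_add_left, inner_add_right, inner_add_right, ← hsymm e c₀,
      real_inner_comm c₀ (M e), real_inner_comm (M e) e]
    ring
  rw [h₀, h₁, hexp, hquad]
  nlinarith [sq_nonneg ‖t + M e‖, mul_nonneg ha (hM e)]

/-- The closed-form weights satisfy the orthogonality conditions of the ridge objective. -/
lemma inner_sub_sum_mulVec_eq_zero {ι : Type*} [Fintype ι] [DecidableEq ι] (v : E) (T w : ι → E)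
    {A : Matrix ι ι ℝ} (hA : ∀ k l, A k l = ⟪T k, w l⟫) (hU : IsUnit A) {d : ι → ℝ}
    (hd : d = A⁻¹ *ᵥ fun k => ⟪T k, v⟫) (k : ι) : ⟪T k, v - ∑ l, d l • w l⟫ = 0 := by
  have hAd : A *ᵥ d = fun k => ⟪T k, v⟫ := by
    rw [hd, mulVec_mulVec, mul_nonsing_inv _ ((isUnit_iff_isUnit_det A).1 hU), one_mulVec]
  have hk := congrFun hAd k
  simp only [mulVec, dotProduct, hA] at hk
  rw [inner_sub_right, inner_sum, ← hk]
  simp [real_inner_smul_right, mul_comm]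

/-- The operator on `Eⁿ` given by a matrix of bounded operators. -/
noncomputable def blockOperator {n : ℕ} (S : Fin n → Fin n → (E →L[ℝ] E)) :
    PiLp 2 (fun _ : Fin n => E) →L[ℝ] PiLp 2 (fun _ : Fin n => E) :=
  (PiLp.continuousLinearEquiv 2 ℝ (fun _ : Fin n => E)).symm.toContinuousLinearMap ∘L
    ContinuousLinearMap.pi fun i => ∑ j, S i j ∘L PiLp.proj 2 (fun _ : Fin n => E) j

lemma blockOperator_apply {n : ℕ} (S : Fin n → Fin n → (E →L[ℝ] E))
    (x : PiLp 2 (fun _ : Fin n => E)) (i : Fin n) : blockOperator S x i = ∑ j, S i j (x j) := by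
  simp [blockOperator]

lemma inner_blockOperator_comm {n : ℕ} {S : Fin n → Fin n → (E →L[ℝ] E)}
    (hadj : ∀ i j (x y : E), ⟪S i j x, y⟫ = ⟪x, S j i y⟫) (x y : PiLp 2 (fun _ : Fin n => E)) :
    ⟪blockOperator S x, y⟫ = ⟪x, blockOperator S y⟫ := by
  simp only [PiLp.inner_apply, blockOperator_apply, sum_inner, inner_sum, hadj]
  exact Finset.sum_comm

end Ridge

/-- closed form of the ridge-regression weights. Given `u ∈ Yⁿ`, `T¹,…,T^r ∈ Yⁿ`,
bounded operators `Σ_{ij}` with `Σ_{ij}* = Σ_{ji}` whose block operator `M` is positive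
semidefinite, the operator `M_λ = M + nλ Id` is self-adjoint, strictly positive and boundedly
invertible, and if the matrix `𝐀_{kl} = ⟨T^k, M_λ⁻¹ T^l⟩` is invertible then
`d* = 𝐀⁻¹(⟨T^k, M_λ⁻¹ u⟩)_k`, `c* = M_λ⁻¹ u − ∑_k d*_k M_λ⁻¹ T^k` minimize the ridge
objective. -/
theorem ridge_regression_closed_form {Y : Type*} [NormedAddCommGroup Y]
    [InnerProductSpace ℝ Y] [CompleteSpace Y]
    (n r : ℕ) (hn : 1 ≤ n) (hr : 1 ≤ r) (lam : ℝ) (hlam : 0 < lam)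
    (u : Fin n → Y) (T : Fin r → Fin n → Y)
    (S : Fin n → Fin n → (Y →L[ℝ] Y))
    (hadj : ∀ i j (x y : Y), ⟪S i j x, y⟫ = ⟪x, S j i y⟫)
    (hpsd : ∀ h : Fin n → Y, 0 ≤ ∑ i, ⟪∑ j, S i j (h j), h i⟫) :
    ∃ Minv : (Fin n → Y) → (Fin n → Y),
      -- M_λ has (bounded) two-sided inverse Minv
      (∀ h i, (∑ j, S i j (Minv h j)) + ((n : ℝ) * lam) • Minv h i = h i) ∧
      (∀ h : Fin n → Y,
        Minv (fun i => (∑ j, S i j (h j)) + ((n : ℝ) * lam) • h i) = h) ∧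
      (∃ C : ℝ, 0 < C ∧ ∀ h : Fin n → Y,
        ∑ i, ‖Minv h i‖ ^ 2 ≤ C * ∑ i, ‖h i‖ ^ 2) ∧
      -- M_λ is self-adjoint
      (∀ h g : Fin n → Y,
        ∑ i, ⟪(∑ j, S i j (h j)) + ((n : ℝ) * lam) • h i, g i⟫ =
          ∑ i, ⟪h i, (∑ j, S i j (g j)) + ((n : ℝ) * lam) • g i⟫) ∧
      -- M_λ is strictly positive
      (∀ h : Fin n → Y, h ≠ 0 →
        0 < ∑ i, ⟪(∑ j, S i j (h j)) + ((n : ℝ) * lam) • h i, h i⟫) ∧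
      -- optimality of the closed-form weights
      (∀ A : Matrix (Fin r) (Fin r) ℝ,
        (∀ k l, A k l = ∑ i, ⟪T k i, Minv (T l) i⟫) →
        IsUnit A →
        ∀ (dstar : Fin r → ℝ) (cstar : Fin n → Y),
          dstar = A⁻¹ *ᵥ (fun k => ∑ i, ⟪T k i, Minv u i⟫) →
          cstar = (fun i => Minv u i - ∑ k, dstar k • Minv (T k) i) →
          ∀ (d : Fin r → ℝ) (c : Fin n → Y),
            (∑ i, ‖u i - (∑ k, dstar k • T k i) - ∑ j, S i j (cstar j)‖ ^ 2) +
              (n : ℝ) * lam * ∑ i, ∑ j, ⟪cstar i, S i j (cstar j)⟫ ≤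
            (∑ i, ‖u i - (∑ k, d k • T k i) - ∑ j, S i j (c j)‖ ^ 2) +
              (n : ℝ) * lam * ∑ i, ∑ j, ⟪c i, S i j (c j)⟫) := by
  set a : ℝ := (n : ℝ) * lam
  have ha : 0 < a := mul_pos (by exact_mod_cast hn) hlam
  let M : PiLp 2 (fun _ : Fin n => Y) →L[ℝ] PiLp 2 (fun _ : Fin n => Y) := blockOperator S
  have hMi (x : PiLp 2 (fun _ : Fin n => Y)) (i : Fin n) : M x i = ∑ j, S i j (x j) :=
    blockOperator_apply S x i
  have hsymm (x y : PiLp 2 (fun _ : Fin n => Y)) : ⟪M x, y⟫ = ⟪x, M y⟫ :=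
    inner_blockOperator_comm hadj x y
  have hpos (x : PiLp 2 (fun _ : Fin n => Y)) : 0 ≤ ⟪M x, x⟫ := by
    simpa only [PiLp.inner_apply, hMi] using hpsd x
  obtain ⟨U, hU⟩ := isUnit_add_smul_one_of_inner_nonneg M hpos ha
  let R : PiLp 2 (fun _ : Fin n => Y) →L[ℝ] PiLp 2 (fun _ : Fin n => Y) := ↑U⁻¹
  have hMR (x : PiLp 2 (fun _ : Fin n => Y)) : M (R x) + a • R x = x := by
    have h := DFunLike.congr_fun U.mul_inv x
    rwa [hU] at h
  have hRM (x : PiLp 2 (fun _ : Fin n => Y)) : R (M x + a • x) = x := by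
    have h := DFunLike.congr_fun U.inv_mul x
    rwa [hU] at h
  have hlp (h : Fin n → Y) :
      (WithLp.toLp 2 fun i => (∑ j, S i j (h j)) + a • h i : PiLp 2 (fun _ : Fin n => Y)) =
        M (WithLp.toLp 2 h) + a • WithLp.toLp 2 h := by
    ext i
    simp [hMi]
  refine ⟨fun h => R (WithLp.toLp 2 h), fun h i => ?_, fun h => ?_, ?_, fun h g => ?_,
    fun h hh => ?_, ?_⟩
  · simpa [hMi] using congrArg (fun x : PiLp 2 (fun _ : Fin n => Y) => x i) (hMR (WithLp.toLp 2 h))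
  · beta_reduce
    rw [hlp, hRM]
  · refine ⟨‖R‖ ^ 2 + 1, by positivity, fun h => ?_⟩
    have hb : ‖R (WithLp.toLp 2 h)‖ ^ 2 ≤
        (‖R‖ ^ 2 + 1) * ‖(WithLp.toLp 2 h : PiLp 2 (fun _ : Fin n => Y))‖ ^ 2 := by
      have := pow_le_pow_left₀ (norm_nonneg _) (R.le_opNorm (WithLp.toLp 2 h)) 2
      nlinarith [sq_nonneg ‖(WithLp.toLp 2 h : PiLp 2 (fun _ : Fin n => Y))‖]
    simpa only [PiLp.norm_sq_eq_of_L2] using hb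
  · have hs := hsymm (WithLp.toLp 2 h) (WithLp.toLp 2 g)
    simp only [PiLp.inner_apply, hMi] at hs
    simp only [inner_add_left, inner_add_right, Finset.sum_add_distrib, real_inner_smul_left,
      real_inner_smul_right, hs]
  · have hne : 0 < ‖(WithLp.toLp 2 h : PiLp 2 (fun _ : Fin n => Y))‖ ^ 2 := by
      have : (WithLp.toLp 2 h : PiLp 2 (fun _ : Fin n => Y)) ≠ 0 := by simpa using hh
      positivity
    rw [PiLp.norm_sq_eq_of_L2] at hne
    simp only [inner_add_left, Finset.sum_add_distrib, real_inner_smul_left,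
      real_inner_self_eq_norm_sq, ← Finset.mul_sum]
    exact add_pos_of_nonneg_of_pos (hpsd h) (mul_pos ha hne)
  · intro A hA hAU dstar cstar hd hc d c
    let v : PiLp 2 (fun _ : Fin n => Y) := WithLp.toLp 2 u
    let t : Fin r → PiLp 2 (fun _ : Fin n => Y) := fun k => WithLp.toLp 2 (T k)
    have hcs : (WithLp.toLp 2 cstar : PiLp 2 (fun _ : Fin n => Y)) =
        R v - ∑ k, dstar k • R (t k) := by
      ext i
      simp [hc, v, t]
    have horth (k : Fin r) : ⟪t k, (WithLp.toLp 2 cstar : PiLp 2 (fun _ : Fin n => Y))⟫ = 0 := by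
      rw [hcs]
      exact inner_sub_sum_mulVec_eq_zero _ _ _ hA hAU hd k
    have hres : M (WithLp.toLp 2 cstar) + a • WithLp.toLp 2 cstar = v - ∑ k, dstar k • t k := by
      have : (WithLp.toLp 2 cstar : PiLp 2 (fun _ : Fin n => Y)) =
          R (v - ∑ k, dstar k • t k) := by simp [hcs]
      rw [this, hMR]
    have hmin := ridge_objective_le_of_stationary M hsymm hpos ha.le v t hres horth d
      (WithLp.toLp 2 c)
    simpa [PiLp.norm_sq_eq_of_L2, PiLp.inner_apply, hMi, inner_sum, v, t] using hmin
end

section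
/- Let D_X, D_Y be sets, I ⊆ ℝ, and Z = (D_X × I) × (D_Y × I) with points written (x, t, y, s). Let 𝒮 be a Hilbert space of real-valued functions on Z that is a reproducing kernel Hilbert space with reproducing kernel K_symm : Z × Z → ℝ, and suppose every G ∈ 𝒮 is symmetric in its time coordinates: G(x, t, y, s) = G(x, s, y, t) for all arguments. Define 𝒢_causal := { 1_{\{t ≤ s\}} G : G ∈ 𝒮 } (pointwise multiplication by the indicator of t ≤ s), and equip it with the inner product ⟨1_{\{t≤s\}}F, 1_{\{t≤s\}}G⟩_{𝒢_causal} := ⟨F, G⟩_𝒮, which is well defined because any G ∈ 𝒮 is determined by its restriction to {t ≤ s} via time symmetry. Then 𝒢_causal is a reproducing kernel Hilbert space of functions on Z with reproducing kernel K_causal((x,t,y,s), (ξ,τ,η,σ)) = 1_{\{t ≤ s\}} 1_{\{τ ≤ σ\}} K_symm((x,t,y,s), (ξ,τ,η,σ)): its sections belong to 𝒢_causal and ⟨K_causal((x,t,y,s), ·), Ḡ⟩_{𝒢_causal} = Ḡ(x, t, y, s) for all Ḡ ∈ 𝒢_causal. -/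
open scoped RealInnerProductSpace

/-- the causal RKHS. Let `𝒮` be an RKHS of functions on
`Z = (D_X × I) × (D_Y × I)` with kernel `K_symm`, all of whose members are symmetric in the
time coordinates. Then truncation `G ↦ 1_{t ≤ s}·G` is injective on `𝒮` (so the inner product
`⟨1_{t≤s}F, 1_{t≤s}G⟩ := ⟨F,G⟩_𝒮` on `𝒢_causal` is well defined), and `𝒢_causal` is an RKHS
with kernel `K_causal(z, w) = 1_{t≤s}(z) 1_{τ≤σ}(w) K_symm(z, w)`: for every `z` there is a
representative `Kz ∈ 𝒮` whose truncation is the section `K_causal(z, ·)` and such that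
`⟨K_causal(z,·), Ḡ⟩_{𝒢_causal} = ⟨Kz, G⟩_𝒮 = Ḡ(z)` for every `Ḡ = 1_{t≤s}·G ∈ 𝒢_causal`. -/
theorem causal_RKHS {DX DY : Type*} (I : Set ℝ)
    (S : Type*) [NormedAddCommGroup S] [InnerProductSpace ℝ S] [CompleteSpace S]
    (toFun : S →ₗ[ℝ] ((DX × I) × (DY × I) → ℝ)) (hinj : Function.Injective toFun)
    (Ksymm : ((DX × I) × (DY × I)) → ((DX × I) × (DY × I)) → ℝ)
    (hrepr : ∀ z, ∃ kz : S, toFun kz = Ksymm z ∧ ∀ f : S, ⟪f, kz⟫ = toFun f z)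
    (htime : ∀ (g : S) (z : (DX × I) × (DY × I)),
      toFun g ((z.1.1, z.2.2), (z.2.1, z.1.2)) = toFun g z) :
    -- truncation is injective on 𝒮, so the inner product on 𝒢_causal is well defined
    (∀ g h : S,
      (fun z : (DX × I) × (DY × I) =>
          (if (z.1.2 : ℝ) ≤ (z.2.2 : ℝ) then (1 : ℝ) else 0) * toFun g z) =
        (fun z => (if (z.1.2 : ℝ) ≤ (z.2.2 : ℝ) then (1 : ℝ) else 0) * toFun h z) →
      g = h) ∧
    -- 𝒢_causal is an RKHS with kernel K_causal
    ∀ z : (DX × I) × (DY × I), ∃ Kz : S,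
      ((fun w : (DX × I) × (DY × I) =>
          (if (w.1.2 : ℝ) ≤ (w.2.2 : ℝ) then (1 : ℝ) else 0) * toFun Kz w) =
        fun w => (if (z.1.2 : ℝ) ≤ (z.2.2 : ℝ) then (1 : ℝ) else 0) *
          ((if (w.1.2 : ℝ) ≤ (w.2.2 : ℝ) then (1 : ℝ) else 0) * Ksymm z w)) ∧
      (∀ g : S, ⟪g, Kz⟫ =
        (if (z.1.2 : ℝ) ≤ (z.2.2 : ℝ) then (1 : ℝ) else 0) * toFun g z) := by
  refine ⟨fun g h hgh => hinj (funext fun z => ?_), fun z => ?_⟩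
  · rcases le_total (z.1.2 : ℝ) (z.2.2 : ℝ) with hz | hz
    · simpa [hz] using congrFun hgh z
    · have hswap := congrFun hgh ((z.1.1, z.2.2), (z.2.1, z.1.2))
      simp only [if_pos hz, one_mul] at hswap
      rw [← htime g z, ← htime h z, hswap]
  · obtain ⟨kz, hkz, hinner⟩ := hrepr z
    refine ⟨(if (z.1.2 : ℝ) ≤ (z.2.2 : ℝ) then (1 : ℝ) else 0) • kz, funext fun w => ?_,
      fun g => ?_⟩
    · rw [map_smul, hkz, Pi.smul_apply, smul_eq_mul, mul_left_comm]
    · rw [real_inner_smul_right, hinner]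
end

section
/- Let (a_k)_{k≥1} be a real sequence bounded below, and set L := inf_{k≥1} a_k. (i) If there exists a bijection π : ℕ → ℕ such that the rearranged sequence (a_{π(k)})_{k≥1} is nonincreasing, then lim_{k→∞} a_k exists and equals L. (ii) Conversely, if lim_{k→∞} a_k = L and a_k > L for every k, then there exists a bijection π : ℕ → ℕ such that (a_{π(k)})_{k≥1} is nonincreasing. -/
open Filter

/-- An infinite linear order all of whose initial segments are finite is isomorphic to `ℕ`. -/
theorem nonempty_orderIso_nat_of_finite_Iic {α : Type*} [LinearOrder α] [Infinite α]
    (h : ∀ x : α, (Set.Iic x).Finite) : Nonempty (ℕ ≃o α) := by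
  have : WellFoundedLT α := by
    refine ⟨Subrelation.wf ?_ (measure fun x : α => (Set.Iic x).ncard).wf⟩
    exact fun {x y} hxy => Set.ncard_lt_ncard (Set.Iic_ssubset_Iic.mpr hxy) (h y)
  let _ : OrderBot α := WellFoundedLT.toOrderBot α
  let _ : LocallyFiniteOrder α :=
    LocallyFiniteOrder.ofFiniteIcc fun _ y => (h y).subset fun _ hz => hz.2
  let _ : SuccOrder α := LinearLocallyFiniteOrder.succOrder α
  let _ : PredOrder α := LinearLocallyFiniteOrder.predOrder α
  have : NoMaxOrder α := by
    refine ⟨fun x => ?_⟩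
    by_contra! hx
    exact Set.infinite_univ ((h x).subset fun y _ => hx y)
  exact ⟨orderIsoNatOfLinearSuccPredArch.symm⟩

/-- Let `(a_k)` be a real sequence bounded below with `L = inf_k a_k`.
(i) If some bijective rearrangement of `a` is nonincreasing, then `a` converges to `L`.
(ii) Conversely, if `a` converges to `L` and `a k > L` for every `k`, then there is a bijection
`π` making `(a (π k))` nonincreasing. -/
theorem rearrangement_into_sorted_order (a : ℕ → ℝ) (hbdd : BddBelow (Set.range a)) :
    ((∃ π : ℕ ≃ ℕ, Antitone fun k => a (π k)) →
      Tendsto a atTop (nhds (sInf (Set.range a)))) ∧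
    ((Tendsto a atTop (nhds (sInf (Set.range a))) ∧ ∀ k, sInf (Set.range a) < a k) →
      ∃ π : ℕ ≃ ℕ, Antitone fun k => a (π k)) := by
  constructor
  · rintro ⟨π, hπ⟩
    have hrange : Set.range (fun k => a (π k)) = Set.range a := π.surjective.range_comp a
    have hlim := tendsto_atTop_ciInf hπ (hrange ▸ hbdd)
    rw [← sInf_range, hrange] at hlim
    simpa [Function.comp_def] using hlim.comp π.symm.injective.nat_tendsto_atTop
  · rintro ⟨hlim, hlt⟩
    -- Ties between equal values are broken by the index.
    let key : ℕ → ℝᵒᵈ ×ₗ ℕ := fun k => toLex (OrderDual.toDual (a k), k)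
    have hkey : Function.Injective key := fun i j hij => congrArg (fun p => (ofLex p).2) hij
    let e : ℕ ≃ Set.range key := Equiv.ofInjective key hkey
    have : Infinite (Set.range key) := Infinite.of_injective e e.injective
    have hle {i j : ℕ} (hij : e i ≤ e j) : a j ≤ a i := Prod.Lex.monotone_fst (key i) (key j) hij
    have hfin (x : Set.range key) : (Set.Iic x).Finite := by
      obtain ⟨k, rfl⟩ := e.surjective x
      have hsmall : ∀ᶠ j in cofinite, a j < a k :=
        Nat.cofinite_eq_atTop ▸ hlim.eventually_lt_const (hlt k)
      refine (Set.Finite.image e hsmall).subset fun y hy => ?_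
      obtain ⟨j, rfl⟩ := e.surjective y
      exact ⟨j, (hle hy).not_gt, rfl⟩
    obtain ⟨f⟩ := nonempty_orderIso_nat_of_finite_Iic hfin
    exact ⟨f.toEquiv.trans e.symm, fun i j hij => hle (by simpa using hij)⟩
end

section
/- Let m ≥ 1 be an integer and r_1, …, r_m positive reals with r := min_{1≤i≤m} r_i. Then there exist a bijection e : {1, 2, 3, …} → (ℤ_{≥1})^m and a constant C > 0 such that for every n ≥ 1, writing e(n) = (k_1, …, k_m), one has ∏_{i=1}^m k_i^{-r_i} ≤ C · n^{-r/m}. -/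
/-- A countably infinite type graded by `f` with finite sublevel sets has an enumeration in which
the position of each element is at most the size of its sublevel set. -/
theorem exists_equiv_nat_lt_ncard_sublevel {α β : Type*} [Countable α] [Infinite α] [LinearOrder β]
    (f : α → β) (hf : ∀ b, {y | f y ≤ b}.Finite) :
    ∃ e : ℕ ≃ α, ∀ n, n < {y | f y ≤ f (e n)}.ncard := by
  obtain ⟨c, hc⟩ := exists_injective_nat α
  let key : α → β ×ₗ ℕ := fun x => toLex (f x, c x)
  have key_inj : Function.Injective key := fun x y h => hc (congrArg (fun p => (ofLex p).2) h)
  have key_sub (x : α) : {y | key y < key x} ⊆ {y | f y ≤ f x} := fun y hy => by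
    rcases Prod.Lex.toLex_lt_toLex.1 hy with h | h
    · exact h.le
    · exact h.1.le
  let g : α → ℕ := fun x => {y | key y < key x}.ncard
  have g_lt {x y : α} (h : key x < key y) : g x < g y :=
    Set.ncard_lt_ncard
      (Set.ssubset_iff_exists.2 ⟨fun z hz => lt_trans hz h, x, h, lt_irrefl (key x)⟩)
      ((hf (f y)).subset (key_sub y))
  have g_inj : Function.Injective g := fun x y h => by
    rcases lt_trichotomy (key x) (key y) with hlt | heq | hgt
    · exact absurd h (g_lt hlt).ne
    · exact key_inj heq
    · exact absurd h (g_lt hgt).ne'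
  have g_bound (x : α) : g x < {y | f y ≤ f x}.ncard :=
    Set.ncard_lt_ncard
      (Set.ssubset_iff_exists.2 ⟨key_sub x, x, le_rfl, lt_irrefl (key x)⟩) (hf (f x))
  classical
  have : Infinite (Set.range g) := (Set.infinite_range_of_injective g_inj).to_subtype
  let o := Nat.Subtype.orderIsoOfNat (Set.range g)
  let e := o.toEquiv.trans (Equiv.ofInjective g g_inj).symm
  refine ⟨e, fun n => lt_of_le_of_lt ?_ (g_bound (e n))⟩
  have g_e : g (e n) = o n := Equiv.apply_ofInjective_symm g_inj (o n)
  rw [g_e]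
  exact StrictMono.le_apply (f := fun k => (o k : ℕ)) fun a b h => o.strictMono h

theorem setOf_sup_le_eq_piFinset {ι : Type*} [Fintype ι] [DecidableEq ι] (N : ℕ+) :
    {y : ι → ℕ+ | Finset.univ.sup y ≤ N} = Fintype.piFinset fun _ : ι => Finset.Icc 1 N := by
  ext y
  simp [Pi.le_def]

/-- If `r_1, …, r_m` are positive reals with minimum `r`, then there exist an
enumeration `e : ℕ₊ ≃ (ℤ_{≥1})^m` and a constant `C > 0` such that, writing
`e n = (k_1, …, k_m)`, the tensor-product eigenvalues satisfy
`∏ k_i^{-r_i} ≤ C n^{-r/m}`. -/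
theorem tensor_product_polynomial_decay (m : ℕ) (hm : 1 ≤ m) (rr : Fin m → ℝ)
    (hrr : ∀ i, 0 < rr i) (r : ℝ) (hrle : ∀ i, r ≤ rr i) (hrmem : ∃ i, rr i = r) :
    ∃ (e : ℕ+ ≃ (Fin m → ℕ+)) (C : ℝ), 0 < C ∧
      ∀ n : ℕ+, ∏ i, ((e n i : ℕ) : ℝ) ^ (-(rr i)) ≤ C * (n : ℝ) ^ (-(r / (m : ℝ))) := by
  have : Nonempty (Fin m) := ⟨⟨0, hm⟩⟩
  have r_pos : 0 < r := by
    obtain ⟨i, hi⟩ := hrmem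
    exact hi ▸ hrr i
  obtain ⟨e, he⟩ := exists_equiv_nat_lt_ncard_sublevel
    (fun x : Fin m → ℕ+ => Finset.univ.sup x)
    fun N => by rw [setOf_sup_le_eq_piFinset]; exact Finset.finite_toSet _
  refine ⟨Equiv.pnatEquivNat.trans e, 1, one_pos, fun n => ?_⟩
  set k := (Equiv.pnatEquivNat.trans e) n with hk
  have n_le : (n : ℕ) ≤ ((Finset.univ.sup k : ℕ+) : ℕ) ^ m := by
    have h := he (Equiv.pnatEquivNat n)
    rw [setOf_sup_le_eq_piFinset, Set.ncard_coe_finset] at h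
    simp only [Fintype.card_piFinset, PNat.card_Icc, Finset.prod_const, Finset.card_univ,
      Fintype.card_fin, PNat.one_coe, Nat.add_sub_cancel, Equiv.pnatEquivNat_apply] at h
    have := PNat.natPred_add_one n
    simp only [hk, Equiv.trans_apply, Equiv.pnatEquivNat_apply]
    omega
  obtain ⟨i, -, hi⟩ := Finset.exists_mem_eq_sup Finset.univ Finset.univ_nonempty k
  rw [hi] at n_le
  have one_le_k (j : Fin m) : (1 : ℝ) ≤ (k j : ℕ) := by exact_mod_cast (k j).pos
  have n_pos : (0 : ℝ) < (n : ℕ) := by exact_mod_cast n.pos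
  have m_ne : (m : ℝ) ≠ 0 := by exact_mod_cast (by omega : m ≠ 0)
  calc ∏ j, ((k j : ℕ) : ℝ) ^ (-(rr j))
      ≤ ((k i : ℕ) : ℝ) ^ (-(rr i)) := by
        rw [← Finset.mul_prod_erase _ _ (Finset.mem_univ i)]
        refine mul_le_of_le_one_right (by positivity) (Finset.prod_le_one (fun j _ => by positivity)
          fun j _ => Real.rpow_le_one_of_one_le_of_nonpos (one_le_k j) (by linarith [hrr j]))
    _ ≤ ((k i : ℕ) : ℝ) ^ (-r) :=
        Real.rpow_le_rpow_of_exponent_le (one_le_k i) (neg_le_neg (hrle i))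
    _ = (((k i : ℕ) : ℝ) ^ m) ^ (-(r / (m : ℝ))) := by
        rw [← Real.rpow_natCast, ← Real.rpow_mul (by positivity)]
        congr 1
        field_simp
    _ ≤ ((n : ℕ) : ℝ) ^ (-(r / (m : ℝ))) :=
        Real.rpow_le_rpow_of_nonpos n_pos (by exact_mod_cast n_le)
          (neg_nonpos.2 (by positivity))
    _ = 1 * ((n : ℕ) : ℝ) ^ (-(r / (m : ℝ))) := (one_mul _).symm
end

section
/- Let m ≥ 1 be an integer, a_1, …, a_m and r_1, …, r_m positive reals, and r := min_{1≤i≤m} r_i. Then there exist a bijection e : {1, 2, 3, …} → (ℤ_{≥1})^m and a constant c > 0 such that for every n ≥ 1, writing e(n) = (k_1, …, k_m), one has ∏_{i=1}^m exp(−a_i k_i^{r_i}) ≤ exp(−c · n^{r/m}). -/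
/-- The largest coordinate of a multi-index. -/
def maxCoord {m : ℕ} (k : Fin m → ℕ+) : ℕ :=
  Finset.univ.sup fun i => (k i : ℕ)

/-- A power of two which exceeds every coordinate of the multi-index `k`. -/
def dyadicBase {m : ℕ} (k : Fin m → ℕ+) : ℕ :=
  2 ^ (Nat.log 2 (maxCoord k) + 1)

lemma le_maxCoord {m : ℕ} (k : Fin m → ℕ+) (i : Fin m) : (k i : ℕ) ≤ maxCoord k :=
  Finset.le_sup (f := fun i => (k i : ℕ)) (Finset.mem_univ i)

lemma lt_dyadicBase {m : ℕ} (k : Fin m → ℕ+) (i : Fin m) : (k i : ℕ) < dyadicBase k :=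
  (le_maxCoord k i).trans_lt (Nat.lt_pow_succ_log_self one_lt_two _)

/-- The coordinates of `k` read as digits in base `dyadicBase k`, with a leading digit `1`. -/
def dyadicCode {m : ℕ} (k : Fin m → ℕ+) : ℕ :=
  dyadicBase k ^ m + finFunctionFinEquiv fun i => (⟨k i, lt_dyadicBase k i⟩ : Fin (dyadicBase k))

lemma dyadicCode_lt {m : ℕ} (k : Fin m → ℕ+) : dyadicCode k < 2 * dyadicBase k ^ m := by
  rw [dyadicCode, two_mul]
  exact Nat.add_lt_add_left (Fin.is_lt _) _

lemma log_dyadicCode {m : ℕ} (k : Fin m → ℕ+) :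
    Nat.log 2 (dyadicCode k) = (Nat.log 2 (maxCoord k) + 1) * m := by
  have h := dyadicCode_lt k
  apply Nat.log_eq_of_pow_le_of_lt_pow
  · rw [pow_mul]
    exact Nat.le_add_right _ _
  · rw [pow_succ', pow_mul]
    exact h

lemma dyadicCode_injective {m : ℕ} (hm : 1 ≤ m) :
    Function.Injective (dyadicCode : (Fin m → ℕ+) → ℕ) := by
  intro k l h
  have hlog : Nat.log 2 (maxCoord k) + 1 = Nat.log 2 (maxCoord l) + 1 := by
    have := congrArg (Nat.log 2) h
    rw [log_dyadicCode, log_dyadicCode] at this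
    exact Nat.eq_of_mul_eq_mul_right hm this
  have hB : dyadicBase k = dyadicBase l := by rw [dyadicBase, hlog, dyadicBase]
  have key : ∀ (B C : ℕ) (hk : ∀ i, (k i : ℕ) < B) (hl : ∀ i, (l i : ℕ) < C), B = C →
      B ^ m + (finFunctionFinEquiv fun i => (⟨k i, hk i⟩ : Fin B) : ℕ) =
        C ^ m + (finFunctionFinEquiv fun i => (⟨l i, hl i⟩ : Fin C) : ℕ) → k = l := by
    rintro B _ hk hl rfl heq
    have hfun := finFunctionFinEquiv.injective (Fin.ext (Nat.add_left_cancel heq))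
    funext i
    exact PNat.eq (Fin.mk.inj (congrFun hfun i))
  exact key _ _ (lt_dyadicBase k) (lt_dyadicBase l) hB h

lemma dyadicCode_lt_pow {m : ℕ} (hm : 1 ≤ m) (k : Fin m → ℕ+) :
    dyadicCode k < (4 * maxCoord k) ^ m := by
  have hN : maxCoord k ≠ 0 := ((k ⟨0, hm⟩).pos.trans_le (le_maxCoord k _)).ne'
  have hB : dyadicBase k ≤ 2 * maxCoord k := by
    rw [dyadicBase, pow_succ']
    exact Nat.mul_le_mul_left 2 (Nat.pow_log_le_self 2 hN)
  calc dyadicCode k < 2 * dyadicBase k ^ m := dyadicCode_lt k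
    _ ≤ 2 ^ m * (2 * maxCoord k) ^ m :=
      Nat.mul_le_mul (Nat.le_self_pow (by omega) 2) (Nat.pow_le_pow_left hB m)
    _ = (4 * maxCoord k) ^ m := by rw [← mul_pow]; ring

/-- An injection into `ℕ` from an infinite type yields an enumeration along which the
injection dominates the index. -/
lemma exists_equiv_nat_le_of_injective {α : Type*} [Infinite α] {f : α → ℕ}
    (hf : Function.Injective f) : ∃ e : ℕ ≃ α, ∀ n, n ≤ f (e n) := by
  classical
  have : Infinite (Set.range f) := (Set.infinite_range_of_injective hf).to_subtype
  let o := Nat.Subtype.orderIsoOfNat (Set.range f)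
  refine ⟨o.toEquiv.trans (Equiv.ofInjective f hf).symm, fun n => ?_⟩
  have hmono : StrictMono fun n => (o n : ℕ) := fun _ _ h => o.strictMono h
  have := hmono.le_apply (x := n)
  simpa [Equiv.apply_ofInjective_symm] using this

lemma exists_enumeration_le_pow_maxCoord {m : ℕ} (hm : 1 ≤ m) :
    ∃ e : ℕ+ ≃ (Fin m → ℕ+), ∀ n : ℕ+, (n : ℕ) ≤ (4 * maxCoord (e n)) ^ m := by
  have : Nonempty (Fin m) := ⟨⟨0, hm⟩⟩
  obtain ⟨e, he⟩ := exists_equiv_nat_le_of_injective (dyadicCode_injective hm)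
  refine ⟨Equiv.pnatEquivNat.trans e, fun n => ?_⟩
  have h : n.natPred < _ := (he n.natPred).trans_lt (dyadicCode_lt_pow hm _)
  rw [← PNat.natPred_add_one n]
  simpa using Nat.succ_le_of_lt h

/-- If `a_1, …, a_m` and `r_1, …, r_m` are positive reals with `r = min r_i`,
then there exist an enumeration `e : ℕ₊ ≃ (ℤ_{≥1})^m` and a constant `c > 0` such that, writing
`e n = (k_1, …, k_m)`, the tensor-product eigenvalues satisfy
`∏ exp(−a_i k_i^{r_i}) ≤ exp(−c n^{r/m})`. -/
theorem tensor_product_exponential_decay (m : ℕ) (hm : 1 ≤ m) (a rr : Fin m → ℝ)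
    (ha : ∀ i, 0 < a i) (hrr : ∀ i, 0 < rr i)
    (r : ℝ) (hrle : ∀ i, r ≤ rr i) (hrmem : ∃ i, rr i = r) :
    ∃ (e : ℕ+ ≃ (Fin m → ℕ+)) (c : ℝ), 0 < c ∧
      ∀ n : ℕ+, ∏ i, Real.exp (-(a i) * ((e n i : ℕ) : ℝ) ^ (rr i)) ≤
        Real.exp (-(c * (n : ℝ) ^ (r / (m : ℝ)))) := by
  have : Nonempty (Fin m) := ⟨⟨0, hm⟩⟩
  obtain ⟨e, he⟩ := exists_enumeration_le_pow_maxCoord hm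
  obtain ⟨j, hj⟩ := Finite.exists_min a
  have hr : 0 < r := by
    obtain ⟨i, rfl⟩ := hrmem
    exact hrr i
  refine ⟨e, a j / 4 ^ r, div_pos (ha j) (by positivity), fun n => ?_⟩
  rw [← Real.exp_sum, Real.exp_le_exp]
  simp only [neg_mul, Finset.sum_neg_distrib, neg_le_neg_iff]
  obtain ⟨i, -, hi⟩ := Finset.exists_mem_eq_sup Finset.univ Finset.univ_nonempty
    fun i => (e n i : ℕ)
  have hmax : maxCoord (e n) = (e n i : ℕ) := hi
  have hone : (1 : ℝ) ≤ ((e n i : ℕ) : ℝ) := by exact_mod_cast (e n i).pos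
  have hn : (n : ℝ) ≤ (4 * ((e n i : ℕ) : ℝ)) ^ m := by
    have := he n
    rw [hmax] at this
    exact_mod_cast this
  have hm0 : (m : ℝ) ≠ 0 := by positivity
  have hpow : (n : ℝ) ^ (r / (m : ℝ)) ≤ 4 ^ r * ((e n i : ℕ) : ℝ) ^ r := by
    calc (n : ℝ) ^ (r / (m : ℝ)) ≤ ((4 * ((e n i : ℕ) : ℝ)) ^ m) ^ (r / (m : ℝ)) := by
          gcongr
      _ = (4 * ((e n i : ℕ) : ℝ)) ^ r := by
          rw [← Real.rpow_natCast, ← Real.rpow_mul (by positivity), mul_div_cancel₀ r hm0]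
      _ = 4 ^ r * ((e n i : ℕ) : ℝ) ^ r := Real.mul_rpow (by norm_num) (by positivity)
  calc a j / 4 ^ r * (n : ℝ) ^ (r / (m : ℝ))
      ≤ a j / 4 ^ r * (4 ^ r * ((e n i : ℕ) : ℝ) ^ r) :=
        mul_le_mul_of_nonneg_left hpow (div_nonneg (ha j).le (by positivity))
    _ = a j * ((e n i : ℕ) : ℝ) ^ r := by
        rw [← mul_assoc, div_mul_cancel₀ _ (by positivity)]
    _ ≤ a i * ((e n i : ℕ) : ℝ) ^ rr i :=
        mul_le_mul (hj i) (Real.rpow_le_rpow_of_exponent_le hone (hrle i)) (by positivity)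
          (ha i).le
    _ ≤ ∑ i, a i * ((e n i : ℕ) : ℝ) ^ rr i :=
        Finset.single_le_sum (f := fun i => a i * ((e n i : ℕ) : ℝ) ^ rr i)
          (fun i _ => mul_nonneg (ha i).le (by positivity)) (Finset.mem_univ i)
end
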